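/- Let Ω, Σ be non-isotropic weights on ℝ^N built from weight functions. The space S_Ω^Σ(ℝ^N) is closed under differentiation and under multiplication by monomials: for every f ∈ S_Ω^Σ(ℝ^N) and every multi-index α ∈ ℕ_0^N, both D^α f ∈ S_Ω^Σ(ℝ^N) and x^α f ∈ S_Ω^Σ(ℝ^N). -/

import Mathlib

open MeasureTheory Filter
open scoped ENNReal NNReal

noncomputable section

/-- Euclidean pairing `x·ξ = ∑ x_j ξ_j`. -/
def dotR {M : ℕ} (x ξ : Fin M → ℝ) : ℝ := ∑ j, x j * ξ j

/-- Fourier transform with kernel `e^{-i x·ξ}`. -/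
def FT {M : ℕ} (f : (Fin M → ℝ) → ℂ) (ξ : Fin M → ℝ) : ℂ :=
  ∫ x, Complex.exp (-(Complex.I * (dotR x ξ : ℂ))) * f x

/-- sup-norm (in `ℝ≥0∞`) of a complex-valued function. -/
def supNorm {M : ℕ} (f : (Fin M → ℝ) → ℂ) : ℝ≥0∞ := ⨆ x, (‖f x‖₊ : ℝ≥0∞)

/-- partial derivative `∂_j`. -/
def pD {M : ℕ} (j : Fin M) (f : (Fin M → ℝ) → ℂ) : (Fin M → ℝ) → ℂ :=
  fun x => fderiv ℝ f x (Pi.single j 1)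

/-- iterated partial derivative `∂^α`. -/
def pDpow {M : ℕ} (α : Fin M → ℕ) (f : (Fin M → ℝ) → ℂ) : (Fin M → ℝ) → ℂ :=
  ((List.ofFn fun j : Fin M => (pD j)^[α j]).foldr (· ∘ ·) id) f

/-- `D^α = (-i)^{|α|} ∂^α`. -/
def Dpow {M : ℕ} (α : Fin M → ℕ) (f : (Fin M → ℝ) → ℂ) : (Fin M → ℝ) → ℂ :=
  fun x => (-Complex.I) ^ (∑ j, α j) * pDpow α f x

/-- multiplication by the monomial `x^α`. -/
def monMul {M : ℕ} (α : Fin M → ℕ) (f : (Fin M → ℝ) → ℂ) : (Fin M → ℝ) → ℂ :=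
  fun x => ((∏ j, (x j) ^ (α j) : ℝ) : ℂ) * f x

/-- Weight function in the sense of the paper (extended to `ℝ` by `ω x = ω |x|`):
continuous, increasing on `[0,∞)`, nonnegative, together with conditions
(α), (β), (γ), (δ). -/
structure IsWeightFun (ω : ℝ → ℝ) : Prop where
  nonneg : ∀ x, 0 ≤ ω x
  eq_abs : ∀ x, ω x = ω |x|
  continuous : Continuous ω
  mono : MonotoneOn ω (Set.Ici 0)
  alphaCond : ∃ K, 1 ≤ K ∧ ∀ x, 0 ≤ x → ω (2 * x) ≤ K * (1 + ω x)
  betaCond : Filter.Tendsto (fun x => ω x / x) Filter.atTop (nhds 0)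
  gammaCond : ∃ a b : ℝ, 0 < b ∧ ∀ x, 0 ≤ x → a + b * Real.log (1 + x) ≤ ω x
  deltaCond : ConvexOn ℝ (Set.Ici 0) fun t => ω (Real.exp t)

/-- non-isotropic weight `Ω(x) = ω_1(x_1) + ⋯ + ω_M(x_M)`. -/
def wSum {M : ℕ} (ω : Fin M → ℝ → ℝ) (x : Fin M → ℝ) : ℝ := ∑ j, ω j (x j)

/-- Membership in the space `S_Ω^Σ(ℝ^M)`: `f ∈ L¹`, `f` and `f̂` smooth, and for
every `λ > 0` and every multi-index `α`, `‖e^{λΩ} D^α f‖_∞ < ∞` and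
`‖e^{λΣ} D^α f̂‖_∞ < ∞`. -/
structure MemS {M : ℕ} (Om Sig : (Fin M → ℝ) → ℝ) (f : (Fin M → ℝ) → ℂ) : Prop where
  integrable : Integrable f
  smooth : ContDiff ℝ (⊤ : ℕ∞) f
  smooth_ft : ContDiff ℝ (⊤ : ℕ∞) (FT f)
  decay : ∀ lam : ℝ, 0 < lam → ∀ α : Fin M → ℕ,
      supNorm (fun x => (Real.exp (lam * Om x) : ℂ) * Dpow α f x) < ⊤
  decay_ft : ∀ lam : ℝ, 0 < lam → ∀ α : Fin M → ℕ,
      supNorm (fun ξ => (Real.exp (lam * Sig ξ) : ℂ) * Dpow α (FT f) ξ) < ⊤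

section PartialDerivatives

variable {M : ℕ}

theorem contDiff_pD {f : (Fin M → ℝ) → ℂ} (hf : ContDiff ℝ (⊤ : ℕ∞) f) (j : Fin M) :
    ContDiff ℝ (⊤ : ℕ∞) (pD j f) :=
  (hf.fderiv_right (m := (⊤ : ℕ∞)) (by simp)).clm_apply contDiff_const

theorem pD_comm {f : (Fin M → ℝ) → ℂ} (hf : ContDiff ℝ (⊤ : ℕ∞) f) (j k : Fin M) :
    pD j (pD k f) = pD k (pD j f) := by
  have hd : Differentiable ℝ (fderiv ℝ f) :=
    (hf.fderiv_right (m := (⊤ : ℕ∞)) (by simp)).differentiable (by simp)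
  have key : ∀ (i l : Fin M) (x : Fin M → ℝ), pD i (pD l f) x =
      fderiv ℝ (fderiv ℝ f) x (Pi.single i 1) (Pi.single l 1) := by
    intro i l x
    unfold pD
    rw [fderiv_clm_apply (hd x) (differentiableAt_const _)]
    simp
  ext x
  rw [key, key]
  have htwo : (2 : WithTop ℕ∞) ≤ ((⊤ : ℕ∞) : WithTop ℕ∞) :=
    WithTop.coe_le_coe.2 (le_top : (2 : ℕ∞) ≤ ⊤)
  exact hf.contDiffAt.isSymmSndFDerivAt (by simpa using htwo) _ _

theorem pD_add {f g : (Fin M → ℝ) → ℂ} (hf : ContDiff ℝ (⊤ : ℕ∞) f)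
    (hg : ContDiff ℝ (⊤ : ℕ∞) g) (j : Fin M) :
    pD j (fun x => f x + g x) = fun x => pD j f x + pD j g x := by
  ext x
  unfold pD
  rw [fderiv_fun_add (hf.differentiable (by simp) x) (hg.differentiable (by simp) x)]
  rfl

theorem pD_const_mul {f : (Fin M → ℝ) → ℂ} (hf : ContDiff ℝ (⊤ : ℕ∞) f) (c : ℂ)
    (j : Fin M) : pD j (fun x => c * f x) = fun x => c * pD j f x := by
  ext x
  unfold pD
  rw [fderiv_const_mul (hf.differentiable (by simp) x)]
  rfl

theorem contDiff_coord_mul {f : (Fin M → ℝ) → ℂ} (hf : ContDiff ℝ (⊤ : ℕ∞) f) (j : Fin M) :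
    ContDiff ℝ (⊤ : ℕ∞) fun x : Fin M → ℝ => (x j : ℂ) * f x :=
  ((Complex.ofRealCLM.contDiff.comp (contDiff_apply ℝ ℝ j)).mul hf)

theorem pD_coord_mul {f : (Fin M → ℝ) → ℂ} (hf : ContDiff ℝ (⊤ : ℕ∞) f) (j k : Fin M) :
    pD k (fun x => (x j : ℂ) * f x) =
      fun x => (x j : ℂ) * pD k f x + (Pi.single k 1 : Fin M → ℂ) j * f x := by
  ext x
  have hx : HasFDerivAt (fun x : Fin M → ℝ => (x j : ℂ))
      (Complex.ofRealCLM.comp (ContinuousLinearMap.proj j)) x :=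
    (Complex.ofRealCLM.comp
      (ContinuousLinearMap.proj (R := ℝ) (φ := fun _ : Fin M => ℝ) j)).hasFDerivAt
  unfold pD
  rw [(hx.fun_mul (hf.differentiable (by simp) x).hasFDerivAt).fderiv]
  by_cases h : j = k
  · subst h; simp [mul_comm]
  · simp [Pi.single_eq_of_ne h]

/-- The iterates of `∂_j` preserve smoothness and commute with `∂_k`. -/
theorem iterate_pD {f : (Fin M → ℝ) → ℂ} (hf : ContDiff ℝ (⊤ : ℕ∞) f) (j k : Fin M) (n : ℕ) :
    ContDiff ℝ (⊤ : ℕ∞) ((pD j)^[n] f) ∧ pD k ((pD j)^[n] f) = (pD j)^[n] (pD k f) := by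
  induction n with
  | zero => exact ⟨hf, rfl⟩
  | succ n ih =>
    simp only [Function.iterate_succ_apply']
    exact ⟨contDiff_pD ih.1 j, by rw [pD_comm ih.1, ih.2]⟩

/-- The iterated derivative `∂^α` restricted to the coordinates in a list. -/
def pDlist (l : List (Fin M)) (α : Fin M → ℕ) (f : (Fin M → ℝ) → ℂ) : (Fin M → ℝ) → ℂ :=
  l.foldr (fun j g => (pD j)^[α j] g) f

theorem pDpow_eq_pDlist (α : Fin M → ℕ) (f : (Fin M → ℝ) → ℂ) :
    pDpow α f = pDlist (List.finRange M) α f := by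
  unfold pDpow pDlist
  rw [List.ofFn_eq_map]
  induction List.finRange M with
  | nil => rfl
  | cons j l ih => simp only [List.map_cons, List.foldr_cons, Function.comp_apply, ih]

theorem pDlist_smooth {f : (Fin M → ℝ) → ℂ} (hf : ContDiff ℝ (⊤ : ℕ∞) f) (k : Fin M)
    (l : List (Fin M)) (α : Fin M → ℕ) :
    ContDiff ℝ (⊤ : ℕ∞) (pDlist l α f) ∧ pD k (pDlist l α f) = pDlist l α (pD k f) := by
  induction l with
  | nil => exact ⟨hf, rfl⟩
  | cons j l ih =>
    refine ⟨(iterate_pD ih.1 j k _).1, ?_⟩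
    change pD k ((pD j)^[α j] (pDlist l α f)) = (pD j)^[α j] (pDlist l α (pD k f))
    rw [(iterate_pD ih.1 j k _).2, ih.2]

theorem pDlist_update_of_notMem {l : List (Fin M)} {k : Fin M} (hk : k ∉ l) (α : Fin M → ℕ)
    (n : ℕ) (f : (Fin M → ℝ) → ℂ) : pDlist l (Function.update α k n) f = pDlist l α f := by
  induction l with
  | nil => rfl
  | cons j l ih =>
    rw [List.mem_cons, not_or] at hk
    change (pD j)^[Function.update α k n j] (pDlist l (Function.update α k n) f) =
      (pD j)^[α j] (pDlist l α f)
    rw [ih hk.2, Function.update_of_ne (Ne.symm hk.1)]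

theorem pDlist_pD {f : (Fin M → ℝ) → ℂ} (hf : ContDiff ℝ (⊤ : ℕ∞) f) {k : Fin M}
    {l : List (Fin M)} (hl : l.Nodup) (hk : k ∈ l) (α : Fin M → ℕ) :
    pDlist l α (pD k f) = pDlist l (Function.update α k (α k + 1)) f := by
  induction l with
  | nil => simp at hk
  | cons j l ih =>
    rw [List.nodup_cons] at hl
    change (pD j)^[α j] (pDlist l α (pD k f)) =
      (pD j)^[Function.update α k (α k + 1) j] (pDlist l (Function.update α k (α k + 1)) f)
    by_cases h : k = j
    · subst h
      rw [pDlist_update_of_notMem hl.1, Function.update_self, Function.iterate_succ_apply,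
        (pDlist_smooth hf k l α).2]
    · rw [Function.update_of_ne (Ne.symm h),
        ih hl.2 ((List.mem_cons.1 hk).resolve_left h)]

theorem pDpow_pD {f : (Fin M → ℝ) → ℂ} (hf : ContDiff ℝ (⊤ : ℕ∞) f) (k : Fin M)
    (α : Fin M → ℕ) : pDpow α (pD k f) = pDpow (Function.update α k (α k + 1)) f := by
  rw [pDpow_eq_pDlist, pDpow_eq_pDlist,
    pDlist_pD hf (List.nodup_finRange M) (List.mem_finRange k)]

/-- A property stable under each `∂_j` is stable under `∂^α`. -/
theorem pDpow_induction {P : ((Fin M → ℝ) → ℂ) → Prop} (hP : ∀ j f, P f → P (pD j f))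
    {f : (Fin M → ℝ) → ℂ} (hf : P f) (α : Fin M → ℕ) : P (pDpow α f) := by
  rw [pDpow_eq_pDlist]
  induction List.finRange M with
  | nil => exact hf
  | cons j l ih =>
    change P ((pD j)^[α j] (pDlist l α f))
    induction α j with
    | zero => exact ih
    | succ n ihn => rw [Function.iterate_succ_apply']; exact hP j _ ihn

/-- A property stable under multiplication by each coordinate is stable under multiplication by
monomials. -/
theorem monMul_induction {P : ((Fin M → ℝ) → ℂ) → Prop}
    (hP : ∀ (j : Fin M) (f), P f → P fun x => (x j : ℂ) * f x)
    {f : (Fin M → ℝ) → ℂ} (hf : P f) (α : Fin M → ℕ) : P (monMul α f) := by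
  have key : ∀ s : Finset (Fin M), P fun x => ((∏ j ∈ s, x j ^ α j : ℝ) : ℂ) * f x := by
    intro s
    induction s using Finset.induction_on with
    | empty => simpa using hf
    | insert k s hk ih =>
      have hpow : ∀ n : ℕ, P fun x => (x k : ℂ) ^ n * (((∏ j ∈ s, x j ^ α j : ℝ) : ℂ) * f x) := by
        intro n
        induction n with
        | zero => simpa using ih
        | succ n ihn => simpa only [pow_succ', mul_assoc] using hP k _ ihn
      simpa only [Finset.prod_insert hk, Complex.ofReal_mul, Complex.ofReal_pow, mul_assoc]
        using hpow (α k)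
  exact key Finset.univ

end PartialDerivatives

section Decay

variable {M : ℕ}

/-- `f` is bounded by a multiple of `e^{-λΩ}` for every `λ > 0`. -/
def ExpDecay (Om : (Fin M → ℝ) → ℝ) (f : (Fin M → ℝ) → ℂ) : Prop :=
  ∀ lam : ℝ, 0 < lam → ∃ C : ℝ, ∀ x, Real.exp (lam * Om x) * ‖f x‖ ≤ C

/-- The weight `Ω` dominates a multiple of `log (1 + |x|)`, in exponential form. -/
def LogGrowth (Om : (Fin M → ℝ) → ℝ) : Prop :=
  ∃ A c : ℝ, 0 < A ∧ 0 < c ∧ ∀ x, 1 + ‖x‖ ≤ A * Real.exp (c * Om x)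

theorem supNorm_lt_top_iff {f : (Fin M → ℝ) → ℂ} :
    supNorm f < ⊤ ↔ ∃ C : ℝ, ∀ x, ‖f x‖ ≤ C := by
  unfold supNorm
  rw [ENNReal.iSup_coe_lt_top]
  constructor
  · rintro ⟨C, hC⟩
    exact ⟨C, fun x => by exact_mod_cast hC ⟨x, rfl⟩⟩
  · rintro ⟨C, hC⟩
    refine ⟨C.toNNReal, ?_⟩
    rintro _ ⟨x, rfl⟩
    exact NNReal.le_toNNReal_of_coe_le (hC x)

theorem expDecay_Dpow_iff {Om : (Fin M → ℝ) → ℝ} {f : (Fin M → ℝ) → ℂ} {α : Fin M → ℕ} :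
    (∀ lam : ℝ, 0 < lam → supNorm (fun x => (Real.exp (lam * Om x) : ℂ) * Dpow α f x) < ⊤) ↔
      ExpDecay Om (pDpow α f) := by
  unfold ExpDecay Dpow
  simp only [supNorm_lt_top_iff, norm_mul, norm_pow, norm_neg, Complex.norm_I, one_pow, one_mul,
    Complex.norm_real, Real.norm_eq_abs, Real.abs_exp]

theorem integrable_of_pow_mul_le {E : Type*} [NormedAddCommGroup E] {f : (Fin M → ℝ) → E}
    (hc : Continuous f) {C : ℝ} (hC : ∀ x, (1 + ‖x‖) ^ (M + 1) * ‖f x‖ ≤ C) : Integrable f := by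
  have hint : Integrable fun x : Fin M → ℝ => C * (1 + ‖x‖) ^ (-((M : ℝ) + 1)) :=
    (integrable_one_add_norm (by simp)).const_mul C
  refine hint.mono' hc.aestronglyMeasurable (ae_of_all _ fun x => ?_)
  have hpos : 0 < 1 + ‖x‖ := by positivity
  have hrpow : (1 + ‖x‖) ^ (-((M : ℝ) + 1)) = ((1 + ‖x‖) ^ (M + 1))⁻¹ := by
    rw [Real.rpow_neg hpos.le]; norm_cast
  rw [hrpow, ← div_eq_mul_inv, le_div_iff₀ (by positivity), mul_comm]
  exact hC x

namespace ExpDecay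

variable {Om : (Fin M → ℝ) → ℝ} {f g : (Fin M → ℝ) → ℂ}

theorem add (hf : ExpDecay Om f) (hg : ExpDecay Om g) : ExpDecay Om fun x => f x + g x := by
  intro lam hlam
  obtain ⟨C, hC⟩ := hf lam hlam
  obtain ⟨D, hD⟩ := hg lam hlam
  refine ⟨C + D, fun x => ?_⟩
  calc Real.exp (lam * Om x) * ‖f x + g x‖
      ≤ Real.exp (lam * Om x) * (‖f x‖ + ‖g x‖) := by gcongr; exact norm_add_le _ _
    _ ≤ C + D := by rw [mul_add]; exact add_le_add (hC x) (hD x)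

theorem const_mul (hf : ExpDecay Om f) (c : ℂ) : ExpDecay Om fun x => c * f x := by
  intro lam hlam
  obtain ⟨C, hC⟩ := hf lam hlam
  refine ⟨‖c‖ * C, fun x => ?_⟩
  rw [norm_mul, mul_left_comm]
  exact mul_le_mul_of_nonneg_left (hC x) (norm_nonneg _)

theorem coord_mul (hOm : LogGrowth Om) (hf : ExpDecay Om f) (j : Fin M) :
    ExpDecay Om fun x => (x j : ℂ) * f x := by
  obtain ⟨A, c, hA, hc, hgrow⟩ := hOm
  intro lam hlam
  obtain ⟨C, hC⟩ := hf (lam + c) (by positivity)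
  refine ⟨A * C, fun x => ?_⟩
  have hx : ‖(x j : ℂ)‖ ≤ A * Real.exp (c * Om x) := by
    rw [Complex.norm_real]
    linarith [norm_le_pi_norm x j, hgrow x]
  calc Real.exp (lam * Om x) * ‖(x j : ℂ) * f x‖
      = Real.exp (lam * Om x) * (‖(x j : ℂ)‖ * ‖f x‖) := by rw [norm_mul]
    _ ≤ Real.exp (lam * Om x) * (A * Real.exp (c * Om x) * ‖f x‖) := by gcongr
    _ = A * (Real.exp ((lam + c) * Om x) * ‖f x‖) := by rw [add_mul, Real.exp_add]; ring
    _ ≤ A * C := by gcongr; exact hC x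

theorem pow_mul_le (hOm : LogGrowth Om) (hf : ExpDecay Om f) (k : ℕ) :
    ∃ C : ℝ, ∀ x, (1 + ‖x‖) ^ (k + 1) * ‖f x‖ ≤ C := by
  obtain ⟨A, c, hA, hc, hgrow⟩ := hOm
  obtain ⟨C, hC⟩ := hf ((k + 1 : ℕ) * c) (by positivity)
  refine ⟨A ^ (k + 1) * C, fun x => ?_⟩
  calc (1 + ‖x‖) ^ (k + 1) * ‖f x‖ ≤ (A * Real.exp (c * Om x)) ^ (k + 1) * ‖f x‖ := by
        gcongr; exact hgrow x
    _ = A ^ (k + 1) * (Real.exp ((k + 1 : ℕ) * c * Om x) * ‖f x‖) := by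
        rw [mul_pow, ← Real.exp_nat_mul, mul_assoc, mul_assoc]
    _ ≤ A ^ (k + 1) * C := by gcongr; exact hC x

theorem integrable (hOm : LogGrowth Om) (hf : ExpDecay Om f) (hc : Continuous f) :
    Integrable f := by
  obtain ⟨C, hC⟩ := hf.pow_mul_le hOm M
  exact integrable_of_pow_mul_le hc hC

theorem integrable_norm_mul (hOm : LogGrowth Om) (hf : ExpDecay Om f) (hc : Continuous f) :
    Integrable fun x => ‖x‖ * ‖f x‖ := by
  obtain ⟨C, hC⟩ := hf.pow_mul_le hOm (M + 1)
  refine integrable_of_pow_mul_le (C := C) (by fun_prop) fun x => le_trans ?_ (hC x)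
  rw [norm_mul, norm_norm, norm_norm, pow_succ _ (M + 1), mul_assoc]
  gcongr
  linarith

end ExpDecay

/-- A smooth function all of whose derivatives decay faster than every `e^{-λΩ}`. -/
structure SmoothDecay (Om : (Fin M → ℝ) → ℝ) (f : (Fin M → ℝ) → ℂ) : Prop where
  smooth : ContDiff ℝ (⊤ : ℕ∞) f
  decay : ∀ α, ExpDecay Om (pDpow α f)

/-- Decay of the partial derivatives of order at most `n`, taken in any order. -/
def ExpDecayUpTo (Om : (Fin M → ℝ) → ℝ) : ℕ → ((Fin M → ℝ) → ℂ) → Prop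
  | 0, f => ExpDecay Om f
  | n + 1, f => ExpDecay Om f ∧ ∀ j, ExpDecayUpTo Om n (pD j f)

namespace ExpDecayUpTo

variable {Om : (Fin M → ℝ) → ℝ} {f g : (Fin M → ℝ) → ℂ} {n : ℕ}

theorem expDecay (hf : ExpDecayUpTo Om n f) : ExpDecay Om f := by
  cases n with
  | zero => exact hf
  | succ n => exact hf.1

theorem of_succ (hf : ExpDecayUpTo Om (n + 1) f) : ExpDecayUpTo Om n f := by
  induction n generalizing f with
  | zero => exact hf.1
  | succ n ih => exact ⟨hf.1, fun j => ih (hf.2 j)⟩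

theorem add (hfs : ContDiff ℝ (⊤ : ℕ∞) f) (hgs : ContDiff ℝ (⊤ : ℕ∞) g)
    (hf : ExpDecayUpTo Om n f) (hg : ExpDecayUpTo Om n g) :
    ExpDecayUpTo Om n fun x => f x + g x := by
  induction n generalizing f g with
  | zero => exact ExpDecay.add hf hg
  | succ n ih =>
    refine ⟨hf.1.add hg.1, fun j => ?_⟩
    rw [pD_add hfs hgs]
    exact ih (contDiff_pD hfs j) (contDiff_pD hgs j) (hf.2 j) (hg.2 j)

theorem const_mul (hfs : ContDiff ℝ (⊤ : ℕ∞) f) (hf : ExpDecayUpTo Om n f) (c : ℂ) :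
    ExpDecayUpTo Om n fun x => c * f x := by
  induction n generalizing f with
  | zero => exact ExpDecay.const_mul hf c
  | succ n ih =>
    refine ⟨hf.1.const_mul c, fun j => ?_⟩
    rw [pD_const_mul hfs]
    exact ih (contDiff_pD hfs j) (hf.2 j)

theorem coord_mul (hOm : LogGrowth Om) (hfs : ContDiff ℝ (⊤ : ℕ∞) f)
    (hf : ExpDecayUpTo Om n f) (j : Fin M) : ExpDecayUpTo Om n fun x => (x j : ℂ) * f x := by
  induction n generalizing f with
  | zero => exact ExpDecay.coord_mul hOm hf j
  | succ n ih =>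
    refine ⟨hf.1.coord_mul hOm j, fun k => ?_⟩
    rw [pD_coord_mul hfs]
    exact add (contDiff_coord_mul (contDiff_pD hfs k) j) (contDiff_const.mul hfs)
      (ih (contDiff_pD hfs k) (hf.2 k)) (const_mul hfs hf.of_succ _)

end ExpDecayUpTo

namespace SmoothDecay

variable {Om : (Fin M → ℝ) → ℝ} {f : (Fin M → ℝ) → ℂ}

theorem pD (hf : SmoothDecay Om f) (j : Fin M) : SmoothDecay Om (pD j f) :=
  ⟨contDiff_pD hf.smooth j, fun α => by rw [pDpow_pD hf.smooth]; exact hf.decay _⟩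

theorem expDecay (hf : SmoothDecay Om f) : ExpDecay Om f := by
  have h : pDpow 0 f = f := by
    rw [pDpow_eq_pDlist]
    unfold pDlist
    induction List.finRange M with
    | nil => rfl
    | cons j l ih => exact ih
  exact h ▸ hf.decay 0

theorem iff_expDecayUpTo :
    SmoothDecay Om f ↔ ContDiff ℝ (⊤ : ℕ∞) f ∧ ∀ n, ExpDecayUpTo Om n f := by
  refine ⟨fun hf => ⟨hf.smooth, fun n => ?_⟩, fun hf => ⟨hf.1, fun α => ?_⟩⟩
  · induction n generalizing f with
    | zero => exact hf.expDecay
    | succ n ih => exact ⟨hf.expDecay, fun j => ih (hf.pD j)⟩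
  · exact (pDpow_induction (P := fun g => ∀ n, ExpDecayUpTo Om n g)
      (fun j g hg n => (hg (n + 1)).2 j) hf.2 α 0).expDecay

theorem const_mul (hf : SmoothDecay Om f) (c : ℂ) : SmoothDecay Om fun x => c * f x := by
  rw [iff_expDecayUpTo] at hf ⊢
  exact ⟨contDiff_const.mul hf.1, fun n => (hf.2 n).const_mul hf.1 c⟩

theorem coord_mul (hOm : LogGrowth Om) (hf : SmoothDecay Om f) (j : Fin M) :
    SmoothDecay Om fun x => (x j : ℂ) * f x := by
  rw [iff_expDecayUpTo] at hf ⊢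
  exact ⟨contDiff_coord_mul hf.1 j, fun n => (hf.2 n).coord_mul hOm hf.1 j⟩

theorem integrable (hOm : LogGrowth Om) (hf : SmoothDecay Om f) : Integrable f :=
  hf.expDecay.integrable hOm hf.smooth.continuous

end SmoothDecay

theorem memS_iff {Om Sig : (Fin M → ℝ) → ℝ} {f : (Fin M → ℝ) → ℂ} (hOm : LogGrowth Om) :
    MemS Om Sig f ↔ SmoothDecay Om f ∧ SmoothDecay Sig (FT f) := by
  constructor
  · intro h
    exact ⟨⟨h.smooth, fun α => expDecay_Dpow_iff.1 fun lam hlam => h.decay lam hlam α⟩,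
      ⟨h.smooth_ft, fun α => expDecay_Dpow_iff.1 fun lam hlam => h.decay_ft lam hlam α⟩⟩
  · rintro ⟨hf, hF⟩
    exact ⟨hf.integrable hOm, hf.smooth, hF.smooth,
      fun lam hlam α => expDecay_Dpow_iff.2 (hf.decay α) lam hlam,
      fun lam hlam α => expDecay_Dpow_iff.2 (hF.decay α) lam hlam⟩

theorem logGrowth_wSum {ω : Fin M → ℝ → ℝ} (hω : ∀ j, IsWeightFun (ω j)) :
    LogGrowth (wSum ω) := by
  choose a b hb hab using fun j => (hω j).gammaCond
  have hnn : ∀ x, 0 ≤ wSum ω x := fun x => Finset.sum_nonneg fun j _ => (hω j).nonneg _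
  have hA : 0 ≤ ∑ j, Real.exp (-a j / b j) := Finset.sum_nonneg fun j _ => (Real.exp_pos _).le
  have hc : 0 ≤ ∑ j, (b j)⁻¹ := Finset.sum_nonneg fun j _ => (inv_pos.2 (hb j)).le
  refine ⟨1 + ∑ j, Real.exp (-a j / b j), 1 + ∑ j, (b j)⁻¹, by positivity, by positivity,
    fun x => ?_⟩
  have hone : 1 ≤ (1 + ∑ j, Real.exp (-a j / b j)) *
      Real.exp ((1 + ∑ j, (b j)⁻¹) * wSum ω x) :=
    one_le_mul_of_one_le_of_one_le (by linarith)
      (Real.one_le_exp (mul_nonneg (by positivity) (hnn x)))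
  rw [← le_sub_iff_add_le', pi_norm_le_iff_of_nonneg (by linarith)]
  intro j
  rw [le_sub_iff_add_le', Real.norm_eq_abs]
  have hpos : 0 < 1 + |x j| := by positivity
  have hlog : Real.log (1 + |x j|) ≤ -a j / b j + (b j)⁻¹ * ω j (x j) := by
    have h := hab j |x j| (abs_nonneg _)
    rw [← (hω j).eq_abs] at h
    rw [div_eq_inv_mul, ← mul_add, ← div_eq_inv_mul, le_div_iff₀ (hb j)]
    linarith
  calc 1 + |x j| ≤ Real.exp (-a j / b j + (b j)⁻¹ * ω j (x j)) :=
        (Real.log_le_iff_le_exp hpos).1 hlog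
    _ = Real.exp (-a j / b j) * Real.exp ((b j)⁻¹ * ω j (x j)) := Real.exp_add _ _
    _ ≤ (1 + ∑ j, Real.exp (-a j / b j)) * Real.exp ((1 + ∑ j, (b j)⁻¹) * wSum ω x) := by
      have h1 : Real.exp (-a j / b j) ≤ ∑ j, Real.exp (-a j / b j) :=
        Finset.single_le_sum (f := fun j => Real.exp (-a j / b j))
          (fun i _ => (Real.exp_pos _).le) (Finset.mem_univ j)
      have h2 : (b j)⁻¹ ≤ ∑ j, (b j)⁻¹ :=
        Finset.single_le_sum (f := fun j => (b j)⁻¹)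
          (fun i _ => (inv_pos.2 (hb i)).le) (Finset.mem_univ j)
      have h3 : ω j (x j) ≤ wSum ω x :=
        Finset.single_le_sum (f := fun j => ω j (x j))
          (fun i _ => (hω i).nonneg _) (Finset.mem_univ j)
      gcongr
      · linarith
      · exact (hω j).nonneg _
      · linarith

end Decay

section Fourier

variable {M : ℕ}

open Real in
/-- The pairing `x·ξ / 2π`, which turns `VectorFourier.fourierIntegral` into `FT`. -/
def dotCLM (M : ℕ) : (Fin M → ℝ) →L[ℝ] (Fin M → ℝ) →L[ℝ] ℝ :=
  ∑ j, ((2 * π)⁻¹ • ContinuousLinearMap.proj (R := ℝ) (φ := fun _ : Fin M => ℝ) j).smulRight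
    (ContinuousLinearMap.proj (R := ℝ) (φ := fun _ : Fin M => ℝ) j)

open Real in
theorem dotCLM_apply (x ξ : Fin M → ℝ) : dotCLM M x ξ = (2 * π)⁻¹ * dotR x ξ := by
  simp [dotCLM, dotR, Finset.mul_sum, mul_assoc]

open Real FourierTransform in
theorem fourierChar_neg_dotCLM (x ξ : Fin M → ℝ) :
    (𝐞 (-dotCLM M x ξ) : ℂ) = Complex.exp (-(Complex.I * (dotR x ξ : ℂ))) := by
  rw [fourierChar_apply, dotCLM_apply]
  congr 1
  push_cast
  have : (π : ℂ) ≠ 0 := by exact_mod_cast pi_ne_zero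
  field_simp

theorem FT_eq_fourierIntegral (f : (Fin M → ℝ) → ℂ) :
    FT f = VectorFourier.fourierIntegral Real.fourierChar volume (dotCLM M).toLinearMap₁₂ f := by
  ext ξ
  unfold FT VectorFourier.fourierIntegral
  congr 1 with x
  rw [Circle.smul_def, smul_eq_mul, ContinuousLinearMap.toLinearMap₁₂_apply_apply_apply,
    fourierChar_neg_dotCLM]

theorem FT_const_mul (c : ℂ) (f : (Fin M → ℝ) → ℂ) :
    FT (fun x => c * f x) = fun ξ => c * FT f ξ := by
  ext ξ
  unfold FT
  rw [← integral_const_mul]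
  congr 1 with x
  ring

theorem dotR_single (x : Fin M → ℝ) (j : Fin M) : dotR x (Pi.single j 1) = x j := by
  simp [dotR, Pi.single_apply]

theorem dotR_comm (x ξ : Fin M → ℝ) : dotR x ξ = dotR ξ x := by
  simp [dotR, mul_comm]

theorem FT_coord_mul {f : (Fin M → ℝ) → ℂ} (hf : Integrable f)
    (hf' : Integrable fun x => ‖x‖ * ‖f x‖) (j : Fin M) :
    FT (fun x => (x j : ℂ) * f x) = fun ξ => Complex.I * pD j (FT f) ξ := by
  ext ξ
  have hint : Integrable (VectorFourier.fourierSMulRight (dotCLM M) f) := by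
    refine (hf'.const_mul (2 * Real.pi * ‖dotCLM M‖)).mono'
      hf.1.fourierSMulRight (ae_of_all _ fun x => ?_)
    simpa only [mul_assoc] using VectorFourier.norm_fourierSMulRight_le (dotCLM M) f x
  unfold pD
  rw [FT_eq_fourierIntegral f, VectorFourier.fderiv_fourierIntegral _ hf hf',
    Real.fourierIntegral_continuousLinearMap_apply' hint,
    ← FT_eq_fourierIntegral, ← congrFun (FT_const_mul _ _) ξ]
  congr 1 with x
  have : (Real.pi : ℂ) ≠ 0 := by exact_mod_cast Real.pi_ne_zero
  rw [VectorFourier.fourierSMulRight_apply, dotCLM_apply, dotR_single]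
  simp only [smul_eq_mul, Complex.real_smul]
  push_cast
  field_simp
  linear_combination ((x j : ℂ) * f x) * Complex.I_sq

theorem FT_pD {f : (Fin M → ℝ) → ℂ} (hd : Differentiable ℝ f) (hf : Integrable f) (j : Fin M)
    (hf' : Integrable (pD j f)) :
    FT (pD j f) = fun ξ => Complex.I * ((ξ j : ℂ) * FT f ξ) := by
  ext ξ
  let g : (Fin M → ℝ) → ℂ := fun x => Real.fourierChar (-dotCLM M x ξ)
  have hg : ∀ x, fderiv ℝ g x (Pi.single j 1) = -(Complex.I * (ξ j : ℂ)) * g x := by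
    intro x
    have hπ : (Real.pi : ℂ) ≠ 0 := by exact_mod_cast Real.pi_ne_zero
    rw [Real.fderiv_fourierChar_neg_bilinear_left_apply, dotCLM_apply, dotR_comm, dotR_single]
    push_cast
    field_simp
    rfl
  have hmul : ∀ {h : (Fin M → ℝ) → ℂ}, Integrable h → Integrable fun x => g x * h x :=
    fun hh => (Real.fourierIntegral_convergent_iff' (dotCLM M) ξ).2 hh
  have hparts := integral_mul_fderiv_eq_neg_fderiv_mul_of_integrable (μ := volume)
    (f := g) (g := f) (v := Pi.single j 1)
    (by simpa only [hg, mul_assoc] using (hmul hf).const_mul _) (hmul hf') (hmul hf)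
    (fun _ _ => (Real.differentiable_fourierChar_neg_bilinear_left _ _).differentiableAt)
    (fun _ _ => hd.differentiableAt)
  unfold FT
  simp only [← fourierChar_neg_dotCLM]
  refine hparts.trans ?_
  simp only [hg, mul_assoc, neg_mul, integral_neg, neg_neg, integral_const_mul, g]

end Fourier

/-- `S_Ω^Σ(ℝ^N)` is closed under `D^α` and under multiplication by `x^α`. -/
theorem statement_9 (N : ℕ) (ω σ : Fin N → ℝ → ℝ)
    (hω : ∀ j, IsWeightFun (ω j)) (hσ : ∀ j, IsWeightFun (σ j))
    (f : (Fin N → ℝ) → ℂ) (hf : MemS (wSum ω) (wSum σ) f) :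
    ∀ α : Fin N → ℕ,
      MemS (wSum ω) (wSum σ) (Dpow α f) ∧ MemS (wSum ω) (wSum σ) (monMul α f) := by
  intro α
  have hOm := logGrowth_wSum hω
  have hSig := logGrowth_wSum hσ
  rw [memS_iff hOm] at hf
  constructor
  · rw [memS_iff hOm]
    have h := pDpow_induction
      (P := fun g => SmoothDecay (wSum ω) g ∧ SmoothDecay (wSum σ) (FT g))
      (fun j g hg => ⟨hg.1.pD j, by
        rw [FT_pD (hg.1.smooth.differentiable (by simp)) (hg.1.integrable hOm) j
          ((hg.1.pD j).integrable hOm)]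
        exact (hg.2.coord_mul hSig j).const_mul _⟩) hf α
    refine ⟨h.1.const_mul _, ?_⟩
    unfold Dpow
    rw [FT_const_mul]
    exact h.2.const_mul _
  · rw [memS_iff hOm]
    exact monMul_induction
      (P := fun g => SmoothDecay (wSum ω) g ∧ SmoothDecay (wSum σ) (FT g))
      (fun j g hg => ⟨hg.1.coord_mul hOm j, by
        rw [FT_coord_mul (hg.1.integrable hOm)
          (hg.1.expDecay.integrable_norm_mul hOm hg.1.smooth.continuous)]
        exact (hg.2.pD j).const_mul _⟩) hf α

end
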